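/- arXiv:2006.08704 — 2 statements merged into one kernel-verified Lean document; each statement's English description precedes it below -/
import Mathlib

section
/- A group G is left-orderable if and only if for every n ≥ 2 there exist an inhomogeneous circular ordering f on G, a normalized ℤ-valued inhomogeneous 2-cocycle u : G × G → ℤ (i.e., u(1,g) = u(g,1) = 0 for all g and u(h,k) − u(gh,k) + u(g,hk) − u(g,h) = 0 for all g,h,k), and a function d : G → ℤ such that f(g,h) = n·u(g,h) + d(g) + d(h) − d(gh) for all g,h ∈ G (i.e., the set of cohomology classes of circular orderings of G is fully divisible). -/
/-- An inhomogeneous circular ordering on a group `G`. -/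
def IsCircularOrdering {G : Type*} [Group G] (f : G → G → ℤ) : Prop :=
  (∀ g h : G, f g h = 0 ∨ f g h = 1) ∧
  (∀ g : G, f 1 g = 0 ∧ f g 1 = 0) ∧
  (∀ g : G, g ≠ 1 → f g g⁻¹ = 1) ∧
  (∀ g h k : G, f h k - f (g * h) k + f g (h * k) - f g h = 0)

/-- A group is circularly-orderable if it admits an inhomogeneous circular ordering. -/
def CircularlyOrderable (G : Type*) [Group G] : Prop :=
  ∃ f : G → G → ℤ, IsCircularOrdering f

/-- A group is left-orderable if it admits a strict total order invariant under
left multiplication. -/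
def LeftOrderable (G : Type*) [Group G] : Prop :=
  ∃ r : G → G → Prop, IsStrictTotalOrder G r ∧ ∀ a b c : G, r b c → r (a * b) (a * c)

open Filter Topology in
/-- Integer sequences converging along a filter in `ℝ` are eventually constant. -/
theorem exists_eventually_eq_of_tendsto_intCast {α : Type*} {l : Filter α} [l.NeBot]
    {w : α → ℤ} {x : ℝ} (hw : Tendsto (fun k => (w k : ℝ)) l (𝓝 x)) :
    ∃ m : ℤ, x = m ∧ ∀ᶠ k in l, w k = m := by
  obtain ⟨m, rfl⟩ := Int.isClosedEmbedding_coe_real.isClosed_range.mem_of_tendsto hw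
    (Eventually.of_forall fun k => ⟨w k, rfl⟩)
  refine ⟨m, rfl, ?_⟩
  have h : Tendsto w l (𝓝 m) := Int.isClosedEmbedding_coe_real.isInducing.tendsto_nhds_iff.2 hw
  simpa [nhds_discrete] using h

/-- There is an additive retraction of `ℝ` onto `ℚ`. -/
theorem exists_addMonoidHom_real_rat_intCast :
    ∃ p : ℝ →+ ℚ, ∀ m : ℤ, p m = m := by
  obtain ⟨p, hp⟩ := LinearMap.exists_leftInverse_of_injective (Algebra.linearMap ℚ ℝ)
    (LinearMap.ker_eq_bot.2 (algebraMap ℚ ℝ).injective)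
  refine ⟨p.toAddMonoidHom, fun m => ?_⟩
  simpa using LinearMap.congr_fun hp (m : ℚ)

/-- For fixed rational `q`, the number `k! * q` is eventually an integer. -/
theorem eventually_floor_factorial_mul (q : ℚ) :
    ∀ᶠ k : ℕ in Filter.atTop, ((⌊((k + 2).factorial : ℚ) * q⌋ : ℤ) : ℚ)
      = (k + 2).factorial * q := by
  filter_upwards [Filter.eventually_ge_atTop q.den] with k hk
  obtain ⟨c, hc⟩ := Nat.dvd_factorial q.den_pos (hk.trans (Nat.le_add_right k 2))
  have h : ((k + 2).factorial : ℚ) * q = ((c * q.num : ℤ) : ℚ) := by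
    rw [hc]
    push_cast
    rw [mul_comm (q.den : ℚ), mul_assoc, Rat.den_mul_eq_num]
  rw [h, Int.floor_intCast]

open Filter Topology in
/-- Bounded functions `f k` which are coboundaries modulo `(k + 2)!` are, along an ultrafilter,
pointwise eventually integral coboundaries. -/
theorem exists_eventual_primitive {G : Type*} [Mul G] (f : ℕ → G → G → ℤ) (d : ℕ → G → ℤ)
    (hf : ∀ k g h, f k g h = 0 ∨ f k g h = 1)
    (hd : ∀ k g h, ((k + 2).factorial : ℤ) ∣ d k (g * h) - d k g - d k h - f k g h) :
    ∃ b : ℕ → G → ℤ, ∀ g h, ∀ᶠ k in (hyperfilter ℕ : Filter ℕ),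
      b k (g * h) = b k g + b k h + f k g h := by
  have hNpos : ∀ k : ℕ, 0 < ((k + 2).factorial : ℤ) := fun k => by
    exact_mod_cast Nat.factorial_pos _
  have hNpos' : ∀ k : ℕ, 0 < ((k + 2).factorial : ℝ) := fun k => by
    exact_mod_cast Nat.factorial_pos _
  let a : ℕ → G → ℤ := fun k g => d k g % (k + 2).factorial
  have ha : ∀ k g h, ∃ w : ℤ,
      a k (g * h) = a k g + a k h + f k g h + (k + 2).factorial * w := by
    intro k g h
    obtain ⟨c, hc⟩ := hd k g h
    have h1 := Int.emod_add_mul_ediv (d k g) (k + 2).factorial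
    have h2 := Int.emod_add_mul_ediv (d k h) (k + 2).factorial
    have h3 := Int.emod_add_mul_ediv (d k (g * h)) (k + 2).factorial
    refine ⟨c + d k g / (k + 2).factorial + d k h / (k + 2).factorial
      - d k (g * h) / (k + 2).factorial, ?_⟩
    simp only [a]
    linear_combination h3 - h1 - h2 + hc
  choose w hw using ha
  have hlim : ∀ g, ∃ r : ℝ, Tendsto (fun k => (a k g : ℝ) / (k + 2).factorial)
      (hyperfilter ℕ : Filter ℕ) (𝓝 r) := by
    intro g
    obtain ⟨r, -, hr⟩ := (isCompact_Icc (a := (0 : ℝ)) (b := 1)).ultrafilter_le_nhds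
      ((hyperfilter ℕ).map fun k => (a k g : ℝ) / (k + 2).factorial) (by
        refine le_principal_iff.2 (mem_map.2 (Eventually.of_forall fun k : ℕ => ⟨?_, ?_⟩))
        · refine div_nonneg ?_ (hNpos' k).le
          exact_mod_cast Int.emod_nonneg _ (hNpos k).ne'
        · rw [div_le_one (hNpos' k)]
          exact_mod_cast (Int.emod_lt_of_pos (d k g) (hNpos k)).le)
    exact ⟨r, hr⟩
  choose r hr using hlim
  have hfN : ∀ g h, Tendsto (fun k => (f k g h : ℝ) / (k + 2).factorial)
      (hyperfilter ℕ : Filter ℕ) (𝓝 0) := by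
    intro g h
    have hN : Tendsto (fun k : ℕ => ((k + 2).factorial : ℝ)) atTop atTop :=
      tendsto_natCast_atTop_atTop.comp
        (tendsto_atTop_mono (fun k => (Nat.le_add_right k 2).trans (Nat.self_le_factorial _))
          tendsto_id)
    refine squeeze_zero (fun k => ?_) (fun k => ?_)
      (hN.inv_tendsto_atTop.mono_left Nat.hyperfilter_le_atTop)
    · rcases hf k g h with h0 | h0 <;> simp [h0]
    · rcases hf k g h with h0 | h0 <;> simp [h0]
  obtain ⟨p, hp⟩ := exists_addMonoidHom_real_rat_intCast
  refine ⟨fun k g => a k g - ⌊((k + 2).factorial : ℚ) * p (r g)⌋, fun g h => ?_⟩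
  have hwlim : Tendsto (fun k => (w k g h : ℝ)) (hyperfilter ℕ : Filter ℕ)
      (𝓝 (r (g * h) - r g - r h - 0)) := by
    refine ((((hr (g * h)).sub (hr g)).sub (hr h)).sub (hfN g h)).congr fun k => ?_
    have hk : (a k (g * h) : ℝ) = a k g + a k h + f k g h + (k + 2).factorial * w k g h := by
      exact_mod_cast hw k g h
    have := (hNpos' k).ne'
    rw [hk]
    field_simp
    ring
  obtain ⟨m, hm, hwm⟩ := exists_eventually_eq_of_tendsto_intCast hwlim
  have hpm : p (r (g * h)) - p (r g) - p (r h) = m := by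
    rw [← hp, ← hm, sub_zero, map_sub, map_sub]
  have hfl := fun x : G =>
    (eventually_floor_factorial_mul (p (r x))).filter_mono Nat.hyperfilter_le_atTop
  filter_upwards [hwm, hfl g, hfl h, hfl (g * h)] with k hk hg hh hgh
  have hak : (a k (g * h) : ℚ) = a k g + a k h + f k g h + (k + 2).factorial * w k g h := by
    exact_mod_cast hw k g h
  rw [← Int.cast_inj (α := ℚ)]
  push_cast
  rw [hg, hh, hgh, hak, hk]
  linear_combination (-((k + 2).factorial : ℚ)) * hpm

/-- A group with a positive cone is left-orderable. -/
theorem leftOrderable_of_positive_cone {G : Type*} [Group G] (P : G → Prop) (h1 : ¬ P 1)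
    (hmul : ∀ g h, P g → P h → P (g * h)) (htot : ∀ g, g ≠ 1 → P g ∨ P g⁻¹) :
    LeftOrderable G := by
  refine ⟨fun a b => P (a⁻¹ * b),
    { trichotomous := fun a b hab hba => ?_
      irrefl := fun a => by simpa using h1
      trans := fun a b c hab hbc => by simpa [mul_assoc] using hmul _ _ hab hbc },
    fun a b c h => by simpa [mul_assoc] using h⟩
  by_contra hne
  rcases htot (a⁻¹ * b) (by simpa [inv_mul_eq_one] using hne) with h | h
  · exact hab h
  · exact hba (by simpa using h)

open Filter in
theorem leftOrderable_of_eventual_primitive {G : Type*} [Group G] {U : Ultrafilter ℕ}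
    (f : ℕ → G → G → ℤ) (hf : ∀ k, IsCircularOrdering (f k)) (b : ℕ → G → ℤ)
    (hb : ∀ g h, ∀ᶠ k in (U : Filter ℕ), b k (g * h) = b k g + b k h + f k g h) :
    LeftOrderable G := by
  have hone : ∀ᶠ k in (U : Filter ℕ), b k 1 = 0 := by
    filter_upwards [hb 1 1] with k hk
    rw [mul_one, ((hf k).2.1 1).1] at hk
    omega
  have hinv : ∀ g : G, g ≠ 1 → ∀ᶠ k in (U : Filter ℕ), b k g + b k g⁻¹ = -1 := by
    intro g hg
    filter_upwards [hb g g⁻¹, hone] with k hk h1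
    rw [mul_inv_cancel, (hf k).2.2.1 g hg] at hk
    omega
  refine leftOrderable_of_positive_cone
    (fun g => g ≠ 1 ∧ ∀ᶠ k in (U : Filter ℕ), 0 ≤ b k g) (fun h => h.1 rfl) ?_ ?_
  · rintro g h ⟨hg, hg'⟩ ⟨-, hh'⟩
    refine ⟨fun hgh => ?_, ?_⟩
    · obtain rfl : h = g⁻¹ := (inv_eq_of_mul_eq_one_right hgh).symm
      obtain ⟨k, h1, h2, h3⟩ := (hg'.and (hh'.and (hinv g hg))).exists
      omega
    · filter_upwards [hg', hh', hb g h] with k h1 h2 h3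
      rcases (hf k).1 g h with h4 | h4 <;> omega
  · intro g hg
    have : ∀ᶠ k in (U : Filter ℕ), 0 ≤ b k g ∨ 0 ≤ b k g⁻¹ := by
      filter_upwards [hinv g hg] with k hk
      omega
    exact (Ultrafilter.eventually_or.1 this).imp (fun h => ⟨hg, h⟩)
      (fun h => ⟨inv_ne_one.2 hg, h⟩)

/-- A left-orderable group has a circular ordering that is an integral coboundary. -/
theorem LeftOrderable.exists_circularOrdering_eq_coboundary {G : Type*} [Group G]
    (hG : LeftOrderable G) :
    ∃ d : G → ℤ, IsCircularOrdering fun g h : G => d g + d h - d (g * h) := by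
  classical
  obtain ⟨r, hr, hl⟩ := hG
  have hmul : ∀ g h, r g 1 → r h 1 → r (g * h) 1 := fun g h hg hh =>
    hr.trans _ _ _ (by simpa using hl g _ _ hh) hg
  have hpos : ∀ g h, ¬ r g 1 → ¬ r h 1 → ¬ r (g * h) 1 := by
    intro g h hg hh hgh
    rcases eq_or_ne h 1 with rfl | hne
    · exact hg (by simpa using hgh)
    · have h1 : r 1 h := by
        by_contra hc
        exact hne (hr.trichotomous _ _ hh hc)
      exact hg (hr.trans _ _ _ (by simpa using hl g _ _ h1) hgh)
  have hone : ¬ r 1 1 := hr.irrefl 1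
  refine ⟨fun g => if r g 1 then 1 else 0, fun g h => ?_, fun g => ?_, fun g hg => ?_,
    fun g h k => ?_⟩
  · have h1 := hmul g h
    have h2 := hpos g h
    by_cases hg : r g 1 <;> by_cases hh : r h 1 <;> by_cases hgh : r (g * h) 1 <;>
      simp_all
  · simp [hone]
  · have hiff : r g⁻¹ 1 ↔ ¬ r g 1 := by
      constructor
      · intro h h'
        exact hone (by simpa using hmul _ _ h h')
      · intro h
        have h1 : r 1 g := by
          by_contra hc
          exact hg (hr.trichotomous _ _ h hc)
        simpa using hl g⁻¹ _ _ h1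
    by_cases h : r g 1 <;> simp [hiff, h, hone]
  · simp only [mul_assoc]
    ring

/-- A group `G` is left-orderable if and only if the set of cohomology classes of
circular orderings of `G` is fully divisible: for every `n ≥ 2` there is a circular
ordering `f` of `G` with `f = n·u + δd` for some normalized integral 2-cocycle `u`
and some function `d : G → ℤ`. -/
theorem leftOrderable_iff_fully_divisible {G : Type*} [Group G] :
    LeftOrderable G ↔
      ∀ n : ℕ, 2 ≤ n →
        ∃ f : G → G → ℤ, IsCircularOrdering f ∧
          ∃ (u : G → G → ℤ) (d : G → ℤ),
            (∀ g : G, u 1 g = 0 ∧ u g 1 = 0) ∧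
            (∀ g h k : G, u h k - u (g * h) k + u g (h * k) - u g h = 0) ∧
            (∀ g h : G, f g h = n * u g h + d g + d h - d (g * h)) := by
  constructor
  · intro hG n _
    obtain ⟨d, hd⟩ := hG.exists_circularOrdering_eq_coboundary
    exact ⟨_, hd, fun _ _ => 0, d, by simp, by simp, by simp⟩
  · intro H
    have hN : ∀ k : ℕ, 2 ≤ (k + 2).factorial := fun k =>
      (Nat.le_add_left 2 k).trans (Nat.self_le_factorial _)
    choose f hf u d _ _ hfd using fun k => H _ (hN k)
    obtain ⟨b, hb⟩ := exists_eventual_primitive f (fun k g => -d k g) (fun k => (hf k).1)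
      (fun k g h => ⟨-u k g h, by linear_combination -hfd k g h⟩)
    exact leftOrderable_of_eventual_primitive f hf b hb
end

section
/- Let G be a circularly-orderable group that is not left-orderable, and suppose the second group cohomology H²(G;ℤ) with trivial integer coefficients has finite exponent e ≥ 2 with e prime. Then for every n ≥ 2, the product G × ℤ/nℤ is not circularly-orderable if and only if e divides n (i.e., Ob(G) = eℕ). -/
namespace LeftOrderable

/-- A group with a positive cone is left-orderable. -/
theorem of_posCone {G : Type*} [Group G] (P : G → Prop) (hmul : ∀ a b, P a → P b → P (a * b))
    (hone : ¬ P 1) (htot : ∀ a, a ≠ 1 → P a ∨ P a⁻¹) : LeftOrderable G := by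
  refine ⟨fun a b => P (a⁻¹ * b), ?_, fun a b c h => by simpa [mul_assoc] using h⟩
  exact
    { irrefl := fun a h => hone (by simpa using h)
      trans := fun a b c h₁ h₂ => by simpa [mul_assoc] using hmul _ _ h₁ h₂
      trichotomous := fun a b h₁ h₂ => by
        by_contra hab
        rcases htot (a⁻¹ * b) (fun h => hab (inv_mul_eq_one.mp h)) with h | h
        · exact h₁ h
        · exact h₂ (by simpa using h) }

theorem of_injective {G H : Type*} [Group G] [Group H] (φ : G →* H)
    (hφ : Function.Injective φ) (hH : LeftOrderable H) : LeftOrderable G := by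
  obtain ⟨r, hr, hmul⟩ := hH
  refine of_posCone (fun a => r 1 (φ a)) (fun a b ha hb => ?_) (by simpa using hr.irrefl 1)
    fun a ha => ?_
  · have := hmul (φ a) _ _ hb
    rw [mul_one, ← map_mul] at this
    exact hr.trans _ _ _ ha this
  · by_contra! h
    refine ha (hφ ?_)
    rw [map_one]
    refine (hr.trichotomous _ _ h.1 fun h' => h.2 ?_).symm
    simpa using hmul (φ a)⁻¹ _ _ h'

theorem eq_one_of_pow_eq_one {G : Type*} [Group G] (hG : LeftOrderable G) {a : G} {n : ℕ}
    (hn : n ≠ 0) (ha : a ^ n = 1) : a = 1 := by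
  obtain ⟨r, hr, hmul⟩ := hG
  have key : ∀ b : G, r 1 b → ∀ m : ℕ, r 1 (b ^ (m + 1)) := by
    intro b hb m
    induction m with
    | zero => simpa using hb
    | succ m ih =>
      have := hmul (b ^ (m + 1)) _ _ hb
      rw [mul_one, ← pow_succ] at this
      exact hr.trans _ _ _ ih this
  obtain ⟨m, rfl⟩ := Nat.exists_eq_succ_of_ne_zero hn
  refine (hr.trichotomous _ _ (fun h => ?_) fun h => ?_).symm
  · have := key a h m
    rw [ha] at this
    exact hr.irrefl _ this
  · have := key a⁻¹ (by simpa using hmul a⁻¹ _ _ h) m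
    rw [inv_pow, ha, inv_one] at this
    exact hr.irrefl _ this

end LeftOrderable

/-- The underlying set `ℤ × G` of the central extension of `G` by `ℤ` with cocycle `f`. -/
@[ext]
structure CentralExt {G : Type*} (f : G → G → ℤ) where
  /-- The central coordinate. -/
  fst : ℤ
  /-- The projection to the quotient. -/
  snd : G

namespace IsCircularOrdering

variable {G : Type*} [Group G] {f : G → G → ℤ}

/-- The group structure on the central extension defined by a circular ordering. -/
abbrev centralExtGroup (hf : IsCircularOrdering f) : Group (CentralExt f) :=
  letI : Mul (CentralExt f) := ⟨fun a b => ⟨a.fst + b.fst + f a.snd b.snd, a.snd * b.snd⟩⟩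
  letI : One (CentralExt f) := ⟨⟨0, 1⟩⟩
  letI : Inv (CentralExt f) := ⟨fun a => ⟨-a.fst - f a.snd⁻¹ a.snd, a.snd⁻¹⟩⟩
  Group.ofLeftAxioms
    (fun a b c => by
      have h := hf.2.2.2 a.snd b.snd c.snd
      refine CentralExt.ext ?_ (mul_assoc _ _ _)
      change a.fst + b.fst + f a.snd b.snd + c.fst + f (a.snd * b.snd) c.snd =
        a.fst + (b.fst + c.fst + f b.snd c.snd) + f a.snd (b.snd * c.snd)
      linarith)
    (fun a => CentralExt.ext
      (by change 0 + a.fst + f 1 a.snd = a.fst; rw [(hf.2.1 _).1]; ring) (one_mul _))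
    (fun a => CentralExt.ext
      (by change -a.fst - f a.snd⁻¹ a.snd + a.fst + f a.snd⁻¹ a.snd = 0; ring)
      (inv_mul_cancel _))

theorem leftOrderable_centralExt (hf : IsCircularOrdering f) :
    letI := hf.centralExtGroup
    LeftOrderable (CentralExt f) := by
  let _ := hf.centralExtGroup
  refine LeftOrderable.of_posCone (fun a => 0 ≤ a.fst ∧ a ≠ 1) ?_ (fun h => h.2 rfl) ?_
  · rintro ⟨k, g⟩ ⟨l, h⟩ ⟨hk, hg⟩ ⟨hl, hh⟩
    have h01 := hf.1 g h
    refine ⟨?_, fun heq => ?_⟩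
    · change 0 ≤ k + l + f g h
      simp only at hk hl
      omega
    · have h₁ : k + l + f g h = 0 := congrArg CentralExt.fst heq
      have h₂ : g * h = 1 := congrArg CentralExt.snd heq
      obtain rfl := eq_inv_of_mul_eq_one_right h₂
      simp only at hk hl
      by_cases hg1 : g = 1
      · subst hg1
        have : k = 0 := by omega
        subst this
        exact hg rfl
      · have := hf.2.2.1 g hg1
        omega
  · rintro ⟨k, g⟩ hg
    have h01 := hf.1 g⁻¹ g
    by_cases hk : 0 ≤ k
    · exact Or.inl ⟨hk, hg⟩
    · refine Or.inr ⟨?_, inv_ne_one.mpr hg⟩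
      change 0 ≤ -k - f g⁻¹ g
      omega

/-- A circularly ordered group is the quotient of a left-orderable group by an infinite cyclic
central subgroup, with extension cocycle the circular ordering. -/
theorem exists_leftOrderable_centralExtension {G : Type} [Group G] {f : G → G → ℤ}
    (hf : IsCircularOrdering f) :
    ∃ (E : Type) (_ : Group E) (π : E →* G) (s : G → E) (z : E),
      LeftOrderable E ∧ (∀ x, x * z = z * x) ∧ π z = 1 ∧ (∀ g, π (s g) = g) ∧
      (∀ g h, s g * s h = z ^ f g h * s (g * h)) ∧ ∀ x, π x = 1 → ∃ k : ℤ, x = z ^ k := by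
  let _ := hf.centralExtGroup
  let z : CentralExt f := ⟨1, 1⟩
  have hz : ∀ k : ℤ, z ^ k = ⟨k, 1⟩ := by
    have hadd : ∀ k l : ℤ, (⟨k + l, 1⟩ : CentralExt f) = ⟨k, 1⟩ * ⟨l, 1⟩ := fun k l =>
      CentralExt.ext (by change k + l = k + l + f 1 1; rw [(hf.2.1 1).1]; ring) (mul_one 1).symm
    let φ : Multiplicative ℤ →* CentralExt f :=
      { toFun := fun k => ⟨k.toAdd, 1⟩
        map_one' := rfl
        map_mul' := fun k l => hadd _ _ }
    intro k
    have := map_zpow φ (Multiplicative.ofAdd 1) k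
    rw [← ofAdd_zsmul] at this
    simpa [φ] using this.symm
  refine ⟨CentralExt f, inferInstance,
    { toFun := CentralExt.snd, map_one' := rfl, map_mul' := fun _ _ => rfl }, fun g => ⟨0, g⟩, z,
    hf.leftOrderable_centralExt, fun x => ?_,
    rfl, fun _ => rfl, fun g h => ?_, fun x hx => ⟨x.fst, ?_⟩⟩
  · refine CentralExt.ext ?_ ((mul_one _).trans (one_mul _).symm)
    change x.fst + 1 + f x.snd 1 = 1 + x.fst + f 1 x.snd
    rw [(hf.2.1 _).1, (hf.2.1 _).2]; ring
  · rw [hz]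
    refine CentralExt.ext ?_ (one_mul _).symm
    change 0 + 0 + f g h = f g h + 0 + f 1 (g * h)
    rw [(hf.2.1 _).1]; ring
  · rw [hz]
    exact CentralExt.ext rfl hx

/-- If `f` is a coboundary modulo `n`, then `G × ℤ/n` is circularly-orderable. -/
theorem prod_zmod (hf : IsCircularOrdering f) {n : ℕ} (hn : n ≠ 0) (v : G → ZMod n)
    (hv : ∀ g h, (f g h : ZMod n) = v g + v h - v (g * h)) :
    CircularlyOrderable (G × Multiplicative (ZMod n)) := by
  have : NeZero n := ⟨hn⟩
  let s : G × Multiplicative (ZMod n) → ℕ := fun a => (a.2.toAdd - v a.1).val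
  have hs : ∀ a, ((s a : ℤ) : ZMod n) = a.2.toAdd - v a.1 := fun a => by simp [s]
  have hlt : ∀ a, s a < n := fun a => ZMod.val_lt _
  have hv1 : v 1 = 0 := by
    have := hv 1 1
    rw [(hf.2.1 1).1] at this
    simpa using this.symm
  have hs1 : s 1 = 0 := by simp [s, hv1]
  have hdvd : ∀ a b, (n : ℤ) ∣ s a + s b + f a.1 b.1 - s (a * b) := fun a b => by
    rw [← ZMod.intCast_zmod_eq_zero_iff_dvd]
    push_cast
    have h₁ := hs a
    have h₂ := hs b
    have h₃ := hs (a * b)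
    push_cast at h₁ h₂ h₃
    rw [h₁, h₂, h₃, hv]
    simp only [Prod.snd_mul, Prod.fst_mul, toAdd_mul]
    ring
  choose F hF using hdvd
  have hn' : (0 : ℤ) < n := by positivity
  refine ⟨F, fun a b => ?_, fun a => ?_, fun a ha => ?_, fun a b c => ?_⟩
  · have h := hF a b
    have h01 := hf.1 a.1 b.1
    have ha := hlt a
    have hb := hlt b
    have hab := hlt (a * b)
    have h₁ : F a b < 2 := by
      refine lt_of_mul_lt_mul_left (a := (n : ℤ)) ?_ hn'.le
      omega
    have h₂ : -1 < F a b := by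
      refine lt_of_mul_lt_mul_left (a := (n : ℤ)) ?_ hn'.le
      omega
    omega
  · have h₁ := hF 1 a
    have h₂ := hF a 1
    simp [hs1, (hf.2.1 a.1).1, (hf.2.1 a.1).2, hn] at h₁ h₂
    exact ⟨h₁, h₂⟩
  · have h := hF a a⁻¹
    rw [mul_inv_cancel, hs1] at h
    simp only [Prod.fst_inv] at h
    have ha' := hlt a
    have hb := hlt a⁻¹
    have h01 := hf.1 a.1 a.1⁻¹
    have hpos : 0 < (s a : ℤ) + s a⁻¹ + f a.1 a.1⁻¹ := by
      by_cases h1 : a.1 = 1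
      · have : s a ≠ 0 := fun h0 => ha (by
          simp only [s, ZMod.val_eq_zero, h1, hv1, sub_zero] at h0
          exact Prod.ext h1 h0)
        omega
      · have := hf.2.2.1 _ h1
        omega
    have h₁ : F a a⁻¹ < 2 := by
      refine lt_of_mul_lt_mul_left (a := (n : ℤ)) ?_ hn'.le
      omega
    have h₂ : 0 < F a a⁻¹ := by
      refine lt_of_mul_lt_mul_left (a := (n : ℤ)) ?_ hn'.le
      omega
    omega
  · have h₁ := hF b c
    have h₂ := hF (a * b) c
    have h₃ := hF a (b * c)
    have h₄ := hF a b
    have h₅ := hf.2.2.2 a.1 b.1 c.1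
    rw [mul_assoc] at h₂
    simp only [Prod.fst_mul] at h₂ h₃
    refine (mul_eq_zero.mp ?_).resolve_left hn'.ne'
    linarith

end IsCircularOrdering

/-- In a left-orderable central extension `E` by `⟨z⟩` of a group containing a central cyclic
subgroup of order `n`, the generator `z` has an `n`-th root lying over this subgroup. -/
theorem LeftOrderable.exists_root {E P : Type*} [Group E] [Group P] (hE : LeftOrderable E)
    (π : E →* P) {z : E} (hz : ∀ x, x * z = z * x) (hπz : π z = 1)
    (hker : ∀ x, π x = 1 → ∃ k : ℤ, x = z ^ k) {t : E} (hn : orderOf (π t) ≠ 0) :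
    ∃ w, w ^ orderOf (π t) = z ∧ π w ∈ Subgroup.zpowers (π t) := by
  set n := orderOf (π t) with hn_def
  obtain ⟨r, hr⟩ := hker (t ^ n) (by rw [map_pow, hn_def, pow_orderOf_eq_one])
  have htz : Commute t z := hz t
  have hgcd : Int.gcd n r = 1 := by
    obtain ⟨m, hm⟩ := Int.gcd_dvd_left (n : ℤ) r
    obtain ⟨q, hq⟩ := Int.gcd_dvd_right (n : ℤ) r
    set d := Int.gcd n r with hd
    have hd0 : d ≠ 0 := by
      intro h
      rw [h] at hm
      simp at hm
      exact hn hm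
    have h₁ : t ^ m * z ^ (-q) = 1 := by
      refine hE.eq_one_of_pow_eq_one hd0 ?_
      rw [((htz.zpow_zpow m (-q))).mul_pow, ← zpow_natCast, ← zpow_natCast, ← zpow_mul,
        ← zpow_mul, mul_comm m, ← hm, zpow_natCast, hr, ← zpow_add]
      convert zpow_zero z using 2
      rw [hq]; ring
    have h₂ : π t ^ m = 1 := by
      have := congrArg π h₁
      simpa [hπz] using this
    have h₃ := orderOf_dvd_iff_zpow_eq_one.mpr h₂
    rw [← hn_def] at h₃
    obtain ⟨c, hc⟩ := h₃
    have hn0 : (n : ℤ) ≠ 0 := by exact_mod_cast hn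
    have : (d : ℤ) * c = 1 := by
      refine mul_left_cancel₀ hn0 ?_
      rw [mul_one]
      nth_rewrite 2 [hm]
      rw [hc]; ring
    have := Int.eq_one_of_mul_eq_one_right (by positivity) this
    exact_mod_cast this
  have hbez := Int.gcd_eq_gcd_ab n r
  rw [hgcd] at hbez
  set a := Int.gcdA n r
  set b := Int.gcdB n r
  refine ⟨t ^ b * z ^ a, ?_, b, by simp [hπz]⟩
  rw [(htz.zpow_zpow b a).mul_pow, ← zpow_natCast, ← zpow_natCast, ← zpow_mul, ← zpow_mul,
    mul_comm b, zpow_mul, zpow_natCast, hr, ← zpow_mul, ← zpow_add]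
  convert zpow_one z using 2
  push_cast at hbez
  rw [hbez]; ring

/-- If `G × ℤ/n` has a circular ordering whose restriction to `G` has cohomology class killed by
`n`, then `G` is left-orderable. -/
theorem IsCircularOrdering.leftOrderable_of_prod_zmod {G : Type} [Group G] {n : ℕ} (hn : n ≠ 0)
    {F : G × Multiplicative (ZMod n) → G × Multiplicative (ZMod n) → ℤ}
    (hF : IsCircularOrdering F) (u : G → ℤ)
    (hu : ∀ g h, n * F (g, 1) (h, 1) = u g + u h - u (g * h)) : LeftOrderable G := by
  obtain ⟨E, _, π, s, z, hE, hz, hπz, hπs, hs, hker⟩ :=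
    hF.exists_leftOrderable_centralExtension
  let τ : G × Multiplicative (ZMod n) := (1, Multiplicative.ofAdd 1)
  have hτ : orderOf (π (s τ)) = n := by
    rw [hπs, Prod.orderOf, orderOf_one, Nat.lcm_one_left, orderOf_ofAdd_eq_addOrderOf,
      ZMod.addOrderOf_one]
  obtain ⟨w, hw, b, hb⟩ := hE.exists_root π hz hπz hker (t := s τ) (by rwa [hτ])
  rw [hτ] at hw
  replace hb : π w = τ ^ b := by rw [← hb, hπs]
  have hw1 : (π w).1 = 1 := by simp [hb, τ]
  have hcomm : ∀ x, Commute x w := by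
    intro x
    have hπw : π x * π w = π w * π x :=
      Prod.ext (by simp [hw1]) (mul_comm _ _)
    obtain ⟨k, hk⟩ := hker (x * w * x⁻¹ * w⁻¹) (by
      simp only [map_mul, map_inv]
      rw [hπw]; group)
    have h₁ : x * w * x⁻¹ = z ^ k * w := by rw [← hk]; group
    have h₂ : (x * w * x⁻¹) ^ n = z := by
      rw [conj_pow, hw, hz, mul_assoc, mul_inv_cancel, mul_one]
    have hzw : Commute (z ^ k) w := (show Commute z w from (hz w).symm).zpow_left k
    rw [h₁, hzw.mul_pow, hw, mul_eq_right] at h₂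
    have h₃ := hE.eq_one_of_pow_eq_one hn h₂
    rw [h₃, one_mul] at h₁
    exact mul_inv_eq_iff_eq_mul.mp h₁
  let σ : G →* E := MonoidHom.mk' (fun g => s (g, 1) * w ^ (-u g)) fun g h => by
    have hs' := hs (g, 1) (h, 1)
    simp only [Prod.mk_mul_mk, mul_one] at hs'
    have h₁ := ((hcomm (s (h, 1))).zpow_right (-u g)).eq
    have hwz : z ^ F (g, 1) (h, 1) = w ^ (n * F (g, 1) (h, 1)) := by
      rw [zpow_mul, zpow_natCast, hw]
    calc s (g * h, 1) * w ^ (-u (g * h))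
        = s (g * h, 1) * w ^ (n * F (g, 1) (h, 1) + (-u g + -u h)) := by
          congr 2; linarith [hu g h]
      _ = z ^ F (g, 1) (h, 1) * s (g * h, 1) * w ^ (-u g + -u h) := by
          rw [zpow_add w, hwz, ← mul_assoc, ((hcomm (s (g * h, 1))).zpow_right _).eq]
      _ = s (g, 1) * (s (h, 1) * w ^ (-u g)) * w ^ (-u h) := by
          rw [← hs', zpow_add]; group
      _ = s (g, 1) * w ^ (-u g) * (s (h, 1) * w ^ (-u h)) := by
          rw [h₁]; group
  refine hE.of_injective σ fun g h hgh => ?_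
  have := congrArg (fun x => (π x).1) hgh
  simpa [σ, hπs, hw1] using this

/-- A circular ordering multiplied by the exponent of `H²(G;ℤ)` is a coboundary. -/
theorem IsCircularOrdering.exists_coboundary {G : Type} [Group G] {f : G → G → ℤ}
    (hf : IsCircularOrdering f) (e : ℕ)
    (hexp : AddMonoid.exponent (groupCohomology.H2 (Rep.trivial ℤ G ℤ)) = e) :
    ∃ u : G → ℤ, ∀ g h, e * f g h = u g + u h - u (g * h) := by
  let c : groupCohomology.cocycles₂ (Rep.trivial ℤ G ℤ) :=
    ⟨fun p => f p.1 p.2, (groupCohomology.mem_cocycles₂_def _).mpr hf.2.2.2⟩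
  have h : groupCohomology.H2π (Rep.trivial ℤ G ℤ) (e • c) = 0 := by
    rw [map_nsmul, ← hexp, AddMonoid.exponent_nsmul_eq_zero]
  rw [groupCohomology.H2π_eq_zero_iff] at h
  obtain ⟨u, hu⟩ := h
  refine ⟨u, fun g h => ?_⟩
  have h₁ : u h - u (g * h) + u g = e • f g h := congrFun hu (g, h)
  rw [nsmul_eq_mul] at h₁
  rw [← h₁]
  ring

theorem IsCircularOrdering.comp_injective {G H : Type*} [Group G] [Group H] {f : H → H → ℤ}
    (hf : IsCircularOrdering f) (φ : G →* H) (hφ : Function.Injective φ) :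
    IsCircularOrdering fun g h => f (φ g) (φ h) := by
  refine ⟨fun g h => hf.1 _ _, fun g => ?_, fun g hg => ?_, fun g h k => ?_⟩
  · simpa using hf.2.1 (φ g)
  · simpa using hf.2.2.1 (φ g) ((map_ne_one_iff φ hφ).mpr hg)
  · simpa using hf.2.2.2 (φ g) (φ h) (φ k)

/-- If `G` is circularly-orderable but not left-orderable, and `H²(G;ℤ)` has finite
prime exponent `e`, then the obstruction spectrum of `G` is exactly `eℕ`: for `n ≥ 2`,
the product `G × ℤ/nℤ` fails to be circularly-orderable if and only if `e ∣ n`. -/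
theorem obstruction_spectrum_eq_multiples_of_prime_exponent {G : Type} [Group G]
    (hco : CircularlyOrderable G) (hnlo : ¬ LeftOrderable G)
    (e : ℕ) (he : 2 ≤ e) (hp : Nat.Prime e)
    (hexp : AddMonoid.exponent (groupCohomology.H2 (Rep.trivial ℤ G ℤ)) = e) :
    ∀ n : ℕ, 2 ≤ n →
      (¬ CircularlyOrderable (G × Multiplicative (ZMod n)) ↔ e ∣ n) := by
  intro n hn
  have hn0 : n ≠ 0 := by omega
  constructor
  · intro hnot
    by_contra hdvd
    refine hnot ?_
    obtain ⟨f, hf⟩ := hco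
    obtain ⟨u, hu⟩ := hf.exists_coboundary e hexp
    let c : ZMod n := ((e : ZMod n)⁻¹)
    have hc : c * e = 1 := by
      rw [mul_comm]
      exact ZMod.coe_mul_inv_eq_one e ((Nat.Prime.coprime_iff_not_dvd hp).mpr hdvd)
    refine hf.prod_zmod hn0 (fun g => c * u g) fun g h => ?_
    have h₁ := congrArg (fun k : ℤ => c * (k : ZMod n)) (hu g h)
    simp only [Int.cast_mul, Int.cast_natCast, Int.cast_sub, Int.cast_add, ← mul_assoc, hc,
      one_mul] at h₁
    rw [h₁]
    ring
  · rintro ⟨m, rfl⟩ ⟨F, hF⟩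
    have hf := hF.comp_injective (MonoidHom.inl G _) (fun g h hgh => congrArg Prod.fst hgh)
    obtain ⟨u, hu⟩ := hf.exists_coboundary e hexp
    refine hnlo (hF.leftOrderable_of_prod_zmod hn0 (fun g => m * u g) fun g h => ?_)
    have h₁ := hu g h
    simp only [MonoidHom.inl_apply] at h₁
    push_cast
    linear_combination (m : ℤ) * h₁
end
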